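/- Suppose the subgroup of permutations generated by σ₀ and σ₁ acts transitively on Ω and let r be the number of cycles of σ₀ on Ω. Then the monodromy solving process has exactly r − 1 founder indices, and the modified process which, instead of scanning, directly evaluates σ₁ only at the stored founder indices recovers all d elements of Ω using exactly d + r − 2 oracle queries: r − 1 evaluations of σ₁ (each discovering the initial solution of a new cycle of σ₀) and d − 1 evaluations of σ₀ (d − r of which discover a new element and r − 1 of which close an already-complete cycle other than the last). -/

import Mathlib

/-- State of the monodromy solving process (Algorithm 1): the ordered list `S` of found
solutions, the scan pointer `ptr` (0-based index into `S`), the list `F` of founder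
indices (1-based), and the numbers `n0`, `n1` of oracle queries to `σ₀`, `σ₁` so far. -/
structure MonoState (Ω : Type*) where
  S : List Ω
  ptr : ℕ
  F : List ℕ
  n0 : ℕ
  n1 : ℕ

variable {Ω : Type*} [DecidableEq Ω]

/-- The scan of the inner while-loop: the first index `i ≥ ptr` with `σ₁ S[i] ∉ S`. -/
def monoScan (σ₁ : Equiv.Perm Ω) (S : List Ω) (ptr : ℕ) (dflt : Ω) : Option ℕ :=
  ((List.range S.length).drop ptr).find? fun i => σ₁ (S.getD i dflt) ∉ S

/-- One iteration of the outer while-loop of the monodromy solving process: apply `σ₀` to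
the last found solution; if the result is new, append it; otherwise scan with `σ₁` from
the pointer for a new solution (recording the founder index), failing if the scan finds
none. Oracle queries to `σ₀` and `σ₁` are counted by `n0` and `n1`. -/
def monoStep (σ₀ σ₁ : Equiv.Perm Ω) (dflt : Ω) (st : MonoState Ω) : Option (MonoState Ω) :=
  let q := σ₀ (st.S.getLastD dflt)
  if q ∉ st.S then
    some { st with S := st.S ++ [q], n0 := st.n0 + 1 }
  else
    match monoScan σ₁ st.S st.ptr dflt with
    | none => none
    | some i =>
        some { S := st.S ++ [σ₁ (st.S.getD i dflt)], ptr := i + 1, F := st.F ++ [i + 1],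
               n0 := st.n0 + 1, n1 := st.n1 + (i + 1 - st.ptr) }

/-- Running `k` iterations of the monodromy solving process started from the seed
solution `s₁` (so `S = [s₁]`, pointer `1` (0-based `0`), no founder indices, no queries);
`none` means the process got stuck. -/
def monoRun (σ₀ σ₁ : Equiv.Perm Ω) (s₁ : Ω) (k : ℕ) : Option (MonoState Ω) :=
  (fun o => o.bind (monoStep σ₀ σ₁ s₁))^[k] (some ⟨[s₁], 0, [], 0, 0⟩)

/-- State of the modified (type II unpacking) process: the list `S` of found solutions,
the position `fidx` in the stored founder-index list, and oracle query counters. -/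
structure Mono2State (Ω : Type*) where
  S : List Ω
  fidx : ℕ
  n0 : ℕ
  n1 : ℕ

/-- One iteration of the modified process (type II unpacking): apply `σ₀` to the last
found solution; if new, append it; otherwise directly evaluate `σ₁` at the stored founder
index (1-based, read from `F`) and append the result. -/
def mono2Step (σ₀ σ₁ : Equiv.Perm Ω) (dflt : Ω) (F : List ℕ) (st : Mono2State Ω) :
    Mono2State Ω :=
  let q := σ₀ (st.S.getLastD dflt)
  if q ∉ st.S then
    { st with S := st.S ++ [q], n0 := st.n0 + 1 }
  else
    { S := st.S ++ [σ₁ (st.S.getD (F.getD st.fidx 1 - 1) dflt)], fidx := st.fidx + 1,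
      n0 := st.n0 + 1, n1 := st.n1 + 1 }

/-- Running `k` iterations of the modified process from the seed solution `s₁`, given the
stored list `F` of founder indices. -/
def mono2Run (σ₀ σ₁ : Equiv.Perm Ω) (F : List ℕ) (s₁ : Ω) (k : ℕ) : Mono2State Ω :=
  (mono2Step σ₀ σ₁ s₁ F)^[k] ⟨[s₁], 0, 0, 0⟩

open MulAction Pointwise in
omit [DecidableEq Ω] in
/-- On a finite type, a set mapped into itself by a permutation is stabilized by it. -/
theorem mem_stabilizer_of_forall_apply_mem [Finite Ω] {σ : Equiv.Perm Ω} {T : Set Ω}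
    (h : ∀ x ∈ T, σ x ∈ T) : σ ∈ stabilizer (Equiv.Perm Ω) T := by
  rw [mem_stabilizer_iff]
  refine Set.eq_of_subset_of_ncard_le ?_ ?_ (Set.toFinite T)
  · rintro _ ⟨x, hx, rfl⟩
    exact h x hx
  · exact (Set.ncard_image_of_injective T (MulAction.injective σ)).ge

/-- The set of cycles of `σ` that meet the list `S`. -/
def cyclesMeeting (σ : Equiv.Perm Ω) (S : List Ω) :
    Set (MulAction.orbitRel.Quotient (Subgroup.zpowers σ) Ω) :=
  (fun x => Quotient.mk'' x) '' {x | x ∈ S}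

omit [DecidableEq Ω] in
theorem cyclesMeeting_concat (σ : Equiv.Perm Ω) (S : List Ω) (y : Ω) :
    cyclesMeeting σ (S ++ [y]) = insert (Quotient.mk'' y) (cyclesMeeting σ S) := by
  rw [cyclesMeeting, cyclesMeeting, ← Set.image_insert_eq]
  congr 1
  ext x
  simp [or_comm]

omit [DecidableEq Ω] in
theorem mk_apply_mem_cyclesMeeting {σ : Equiv.Perm Ω} {S : List Ω} {x : Ω} (hx : x ∈ S) :
    Quotient.mk'' (σ x) ∈ cyclesMeeting σ S :=
  ⟨x, hx, Quotient.sound'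
    ⟨⟨σ⁻¹, inv_mem (Subgroup.mem_zpowers σ)⟩, σ.symm_apply_apply x⟩⟩

open Pointwise in
omit [DecidableEq Ω] in
theorem mk_notMem_cyclesMeeting [Finite Ω] {σ : Equiv.Perm Ω} {S : List Ω} {y : Ω}
    (hS : ∀ x ∈ S, σ x ∈ S) (hy : y ∉ S) : Quotient.mk'' y ∉ cyclesMeeting σ S := by
  rintro ⟨x, hx, hxy⟩
  obtain ⟨g, hg⟩ : y ∈ MulAction.orbit (Subgroup.zpowers σ) x := Quotient.exact' hxy.symm
  have hstab := (Subgroup.zpowers_le.2 <|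
    mem_stabilizer_of_forall_apply_mem (T := {x | x ∈ S}) hS) g.2
  refine hy ?_
  change y ∈ {x | x ∈ S}
  rw [← MulAction.mem_stabilizer_iff.1 hstab, ← hg]
  exact Set.smul_mem_smul_set hx

open Pointwise in
omit [DecidableEq Ω] in
/-- A nonempty list closed under two permutations generating a transitive group is exhaustive. -/
theorem forall_mem_of_closed [Finite Ω] {σ₀ σ₁ : Equiv.Perm Ω}
    (htrans : MulAction.IsPretransitive (Subgroup.closure {σ₀, σ₁} : Subgroup (Equiv.Perm Ω)) Ω)
    {S : List Ω} (hne : S ≠ []) (h₀ : ∀ x ∈ S, σ₀ x ∈ S) (h₁ : ∀ x ∈ S, σ₁ x ∈ S) (y : Ω) :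
    y ∈ S := by
  obtain ⟨x, hx⟩ := List.exists_mem_of_ne_nil S hne
  obtain ⟨g, hg⟩ := htrans.exists_smul_eq x y
  have hle : Subgroup.closure {σ₀, σ₁} ≤ MulAction.stabilizer (Equiv.Perm Ω) {x | x ∈ S} := by
    rw [Subgroup.closure_le]
    rintro _ (rfl | rfl)
    · exact mem_stabilizer_of_forall_apply_mem h₀
    · exact mem_stabilizer_of_forall_apply_mem h₁
  change y ∈ {x | x ∈ S}
  rw [← MulAction.mem_stabilizer_iff.1 (hle g.2), ← hg]
  exact Set.smul_mem_smul_set hx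

theorem monoScan_eq_some {σ₁ : Equiv.Perm Ω} {S : List Ω} {ptr i : ℕ} {dflt : Ω}
    (h : monoScan σ₁ S ptr dflt = some i) :
    i < S.length ∧ σ₁ (S.getD i dflt) ∉ S ∧
      ∀ j, ptr ≤ j → j < i → σ₁ (S.getD j dflt) ∈ S := by
  unfold monoScan at h
  rw [List.find?_eq_some_iff_getElem] at h
  obtain ⟨hi, n, hn, rfl, hlt⟩ := h
  simp only [List.length_drop, List.length_range] at hn
  simp only [List.getElem_drop, List.getElem_range, decide_not, Bool.not_eq_true',
    decide_eq_false_iff_not, Bool.not_not, decide_eq_true_eq] at hi hlt ⊢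
  refine ⟨by omega, hi, fun j hj hji => ?_⟩
  have := hlt (j - ptr) (by omega)
  rwa [Nat.add_sub_cancel' hj] at this

theorem monoScan_eq_none {σ₁ : Equiv.Perm Ω} {S : List Ω} {ptr : ℕ} {dflt : Ω}
    (h : monoScan σ₁ S ptr dflt = none) {j : ℕ} (hj : ptr ≤ j) (hjS : j < S.length) :
    σ₁ (S.getD j dflt) ∈ S := by
  unfold monoScan at h
  rw [List.find?_eq_none] at h
  have hmem : j ∈ (List.range S.length).drop ptr := by
    rw [List.mem_drop_iff_getElem]
    exact ⟨j - ptr, by simp; omega, by simp; omega⟩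
  simpa using h j hmem

/-- The properties of the state preserved by every iteration of the solving process. -/
structure MonoInvariant (σ₀ σ₁ : Equiv.Perm Ω) (dflt : Ω) (st : MonoState Ω) : Prop where
  nodup : st.S.Nodup
  ne_nil : st.S ≠ []
  apply_mem : ∀ x ∈ st.S, x ≠ st.S.getLastD dflt → σ₀ x ∈ st.S
  scanned : ∀ j < st.ptr, σ₁ (st.S.getD j dflt) ∈ st.S
  ptr_le : st.ptr ≤ st.S.length
  card_cycles : (cyclesMeeting σ₀ st.S).ncard = st.F.length + 1

namespace MonoInvariant

omit [DecidableEq Ω] in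
theorem initial (σ₀ σ₁ : Equiv.Perm Ω) (s₁ : Ω) :
    MonoInvariant σ₀ σ₁ s₁ ⟨[s₁], 0, [], 0, 0⟩ where
  nodup := List.nodup_singleton s₁
  ne_nil := List.cons_ne_nil _ _
  apply_mem := by simp
  scanned := by simp
  ptr_le := by simp
  card_cycles := by simp [cyclesMeeting]

variable {σ₀ σ₁ : Equiv.Perm Ω} {dflt : Ω} {st : MonoState Ω}

omit [DecidableEq Ω] in
theorem getLastD_mem (h : MonoInvariant σ₀ σ₁ dflt st) : st.S.getLastD dflt ∈ st.S := by
  rw [List.getLastD_eq_getLast?, List.getLast?_eq_some_getLast h.ne_nil]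
  exact List.getLast_mem h.ne_nil

omit [DecidableEq Ω] in
theorem closed (h : MonoInvariant σ₀ σ₁ dflt st) (hq : σ₀ (st.S.getLastD dflt) ∈ st.S)
    (x : Ω) (hx : x ∈ st.S) : σ₀ x ∈ st.S := by
  by_cases hxl : x = st.S.getLastD dflt
  · rwa [hxl]
  · exact h.apply_mem x hx hxl

omit [DecidableEq Ω] in
theorem step_old (h : MonoInvariant σ₀ σ₁ dflt st) (hq : σ₀ (st.S.getLastD dflt) ∉ st.S)
    (a b : ℕ) :
    MonoInvariant σ₀ σ₁ dflt ⟨st.S ++ [σ₀ (st.S.getLastD dflt)], st.ptr, st.F, a, b⟩ where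
  nodup := List.nodup_append.2 ⟨h.nodup, List.nodup_singleton _, fun x hx y hy he =>
    hq (by rwa [← List.mem_singleton.1 hy, ← he])⟩
  ne_nil := by simp
  apply_mem x hx hxl := by
    simp only [List.mem_append, List.mem_singleton, List.getLastD_concat] at hx hxl ⊢
    by_cases hxe : x = st.S.getLastD dflt
    · exact Or.inr (by rw [hxe])
    · exact Or.inl (h.apply_mem x (hx.resolve_right hxl) hxe)
  scanned j hj := by
    change σ₁ ((st.S ++ _).getD j dflt) ∈ st.S ++ _
    rw [List.getD_append _ _ _ _ (lt_of_lt_of_le hj h.ptr_le)]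
    exact List.mem_append_left _ (h.scanned j hj)
  ptr_le := by simpa using h.ptr_le.trans (Nat.le_succ _)
  card_cycles := by
    rw [cyclesMeeting_concat, Set.insert_eq_of_mem, h.card_cycles]
    exact mk_apply_mem_cyclesMeeting h.getLastD_mem

theorem step_new [Finite Ω] (h : MonoInvariant σ₀ σ₁ dflt st)
    (hq : σ₀ (st.S.getLastD dflt) ∈ st.S) {i : ℕ}
    (hi : monoScan σ₁ st.S st.ptr dflt = some i) (a b : ℕ) :
    MonoInvariant σ₀ σ₁ dflt
      ⟨st.S ++ [σ₁ (st.S.getD i dflt)], i + 1, st.F ++ [i + 1], a, b⟩ := by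
  obtain ⟨hiS, hnew, hold⟩ := monoScan_eq_some hi
  refine ⟨?_, by simp, fun x hx hxl => ?_, fun j hj => ?_, ?_, ?_⟩
  · exact List.nodup_append.2 ⟨h.nodup, List.nodup_singleton _, fun x hx y hy he =>
      hnew (by rwa [← List.mem_singleton.1 hy, ← he])⟩
  · simp only [List.mem_append, List.mem_singleton, List.getLastD_concat] at hx hxl ⊢
    exact Or.inl (h.closed hq x (hx.resolve_right hxl))
  · change j < i + 1 at hj
    change σ₁ ((st.S ++ _).getD j dflt) ∈ st.S ++ _
    rw [List.getD_append _ _ _ _ (by omega), List.mem_append]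
    rcases Nat.lt_succ_iff_lt_or_eq.1 hj with hji | rfl
    · rcases lt_or_ge j st.ptr with hjp | hjp
      · exact Or.inl (h.scanned j hjp)
      · exact Or.inl (hold j hjp hji)
    · exact Or.inr (List.mem_singleton_self _)
  · simp only [List.length_append, List.length_singleton]
    omega
  · rw [cyclesMeeting_concat, Set.ncard_insert_of_notMem, h.card_cycles]
    · simp
    · exact mk_notMem_cyclesMeeting (h.closed hq) hnew

theorem exists_monoScan_eq_some [Finite Ω]
    (htrans : MulAction.IsPretransitive (Subgroup.closure {σ₀, σ₁} : Subgroup (Equiv.Perm Ω)) Ω)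
    (h : MonoInvariant σ₀ σ₁ dflt st) (hq : σ₀ (st.S.getLastD dflt) ∈ st.S)
    {y : Ω} (hy : y ∉ st.S) : ∃ i, monoScan σ₁ st.S st.ptr dflt = some i := by
  rw [← Option.ne_none_iff_exists']
  refine fun hnone => hy (forall_mem_of_closed htrans h.ne_nil (h.closed hq) (fun x hx => ?_) y)
  obtain ⟨j, hj, rfl⟩ := List.getElem_of_mem hx
  rw [← List.getD_eq_getElem _ dflt hj]
  rcases lt_or_ge j st.ptr with hjp | hjp
  · exact h.scanned j hjp
  · exact monoScan_eq_none hnone hjp hj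

end MonoInvariant

/-- As long as fewer than `|Ω|` solutions are found, the solving process does not get stuck, and
the modified process with any founder list extending the current one reproduces its list. -/
theorem exists_monoRun_eq_some [Fintype Ω] {σ₀ σ₁ : Equiv.Perm Ω} (s₁ : Ω)
    (htrans : MulAction.IsPretransitive (Subgroup.closure {σ₀, σ₁} : Subgroup (Equiv.Perm Ω)) Ω)
    (k : ℕ) (hk : k < Fintype.card Ω) :
    ∃ st : MonoState Ω, monoRun σ₀ σ₁ s₁ k = some st ∧ MonoInvariant σ₀ σ₁ s₁ st ∧
      st.S.length = k + 1 ∧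
      ∀ F, st.F <+: F → mono2Run σ₀ σ₁ F s₁ k = ⟨st.S, st.F.length, k, st.F.length⟩ := by
  induction k with
  | zero => exact ⟨_, rfl, MonoInvariant.initial σ₀ σ₁ s₁, rfl, fun _ _ => rfl⟩
  | succ k ih =>
    obtain ⟨st, hrun, hinv, hlen, hmod⟩ := ih (by omega)
    have hrun_succ : monoRun σ₀ σ₁ s₁ (k + 1) = monoStep σ₀ σ₁ s₁ st := by
      rw [monoRun, Function.iterate_succ_apply', ← monoRun, hrun, Option.bind_some]
    have hmod_succ (F : List ℕ) : mono2Run σ₀ σ₁ F s₁ (k + 1) =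
        mono2Step σ₀ σ₁ s₁ F (mono2Run σ₀ σ₁ F s₁ k) := by
      rw [mono2Run, Function.iterate_succ_apply', ← mono2Run]
    by_cases hq : σ₀ (st.S.getLastD s₁) ∈ st.S
    · obtain ⟨y, hy⟩ : ∃ y, y ∉ st.S := by
        by_contra! hall
        have huniv : st.S.toFinset = Finset.univ := by ext; simp [hall]
        have hcard := List.toFinset_card_of_nodup hinv.nodup
        rw [huniv, Finset.card_univ] at hcard
        omega
      obtain ⟨i, hi⟩ := hinv.exists_monoScan_eq_some htrans hq hy
      refine ⟨_, hrun_succ.trans ?_,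
        hinv.step_new hq hi (st.n0 + 1) (st.n1 + (i + 1 - st.ptr)), by simp [hlen], ?_⟩
      · simp only [monoStep, hq, not_true_eq_false, if_false, hi]
      · rintro F ⟨G, rfl⟩
        rw [hmod_succ, hmod _ ⟨_, (List.append_assoc _ _ _).symm⟩]
        simp only [mono2Step, hq, not_true_eq_false, if_false]
        simp [List.getD_eq_getElem?_getD]
    · refine ⟨_, hrun_succ.trans ?_, hinv.step_old hq (st.n0 + 1) st.n1, by simp [hlen], ?_⟩
      · simp only [monoStep, hq, not_false_eq_true, if_true]
      · intro F hF
        rw [hmod_succ, hmod F hF]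
        simp only [mono2Step, hq, not_false_eq_true, if_true]

/-- Suppose `⟨σ₀,σ₁⟩` acts transitively on `Ω`, `|Ω| = d ≥ 1`, and `σ₀` has `r` cycles
(orbits of the cyclic subgroup it generates). Then the monodromy solving process records
exactly `r − 1` founder indices; and the modified process, which replays the run but
evaluates `σ₁` directly at the stored founder indices, recovers all `d` elements of `Ω`
using exactly `r − 1` evaluations of `σ₁` and `d − 1` evaluations of `σ₀`, i.e. exactly
`d + r − 2` oracle queries in total. -/
theorem typeII_unpacking {Ω : Type*} [Fintype Ω] [DecidableEq Ω]
    (σ₀ σ₁ : Equiv.Perm Ω) (s₁ : Ω) (hd : 1 ≤ Fintype.card Ω)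
    (htrans : MulAction.IsPretransitive (Subgroup.closure {σ₀, σ₁} : Subgroup (Equiv.Perm Ω)) Ω)
    (r : ℕ) (hr : r = Nat.card (MulAction.orbitRel.Quotient (Subgroup.zpowers σ₀) Ω)) :
    ∃ final : MonoState Ω, monoRun σ₀ σ₁ s₁ (Fintype.card Ω - 1) = some final ∧
      final.F.length = r - 1 ∧
      (mono2Run σ₀ σ₁ final.F s₁ (Fintype.card Ω - 1)).S.Nodup ∧
      (∀ x : Ω, x ∈ (mono2Run σ₀ σ₁ final.F s₁ (Fintype.card Ω - 1)).S) ∧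
      (mono2Run σ₀ σ₁ final.F s₁ (Fintype.card Ω - 1)).n0 = Fintype.card Ω - 1 ∧
      (mono2Run σ₀ σ₁ final.F s₁ (Fintype.card Ω - 1)).n1 = r - 1 ∧
      (mono2Run σ₀ σ₁ final.F s₁ (Fintype.card Ω - 1)).n0 +
          (mono2Run σ₀ σ₁ final.F s₁ (Fintype.card Ω - 1)).n1 =
        Fintype.card Ω + r - 2 := by
  obtain ⟨final, hrun, hinv, hlen, hmod⟩ :=
    exists_monoRun_eq_some s₁ htrans (Fintype.card Ω - 1) (by omega)
  have hall (x : Ω) : x ∈ final.S := by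
    have huniv := (Finset.card_eq_iff_eq_univ final.S.toFinset).1 <| by
      rw [List.toFinset_card_of_nodup hinv.nodup]
      omega
    exact List.mem_toFinset.1 (huniv ▸ Finset.mem_univ x)
  have hF : r = final.F.length + 1 := by
    rw [hr, ← hinv.card_cycles, ← Set.ncard_univ]
    congr 1
    refine (Set.eq_univ_of_forall fun c => ?_).symm
    induction c using Quotient.inductionOn' with
    | h x => exact ⟨x, hall x, rfl⟩
  refine ⟨final, hrun, by omega, ?_⟩
  rw [hmod final.F List.prefix_rfl]
  exact ⟨hinv.nodup, hall, rfl, by simp [hF], by simp only; omega⟩
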